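/- arXiv:2202.02613 — 3 statements merged into one kernel-verified Lean document; each statement's English description precedes it below -/
import Mathlib

section
/- Let P be a 0-sequential rewriting system over a finite alphabet Σ, let x ∈ Σ*, and let r₁, …, r_n ∈ P be productions with r_i = (a_i, β_i). Then there exists a derivation x = x₀ → x₁ → ⋯ → x_n whose i-th step applies production r_i if and only if for every i ∈ {1, …, n} one has |x|_{a_i} + ∑_{j=1}^{i−1} df_{a_i}(r_j) ≥ 1 (sums in ℤ). Moreover, in that case x_n = ε (the empty word) if and only if additionally |x|_B + ∑_{i=1}^{n} df_B(r_i) = 0 for every B ∈ Σ. -/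
/-- A 0-sequential rewriting step applying the specific production `r = (a, β)`:
`x = u ++ [a] ++ v` and `y = u ++ β ++ v`. -/
def ZeroSeqStepWith {α : Type*} (r : α × List α) (x y : List α) : Prop :=
  ∃ u v : List α, x = u ++ r.1 :: v ∧ y = u ++ r.2 ++ v

/-- `DerivList P x rs y` : a derivation from `x` to `y` whose `i`-th step applies
the `i`-th production of the list `rs`, all productions belonging to `P`. -/
inductive DerivList {α : Type*} (P : Finset (α × List α)) :
    List α → List (α × List α) → List α → Prop
  | nil (x : List α) : DerivList P x [] x
  | cons {x y z : List α} {r : α × List α} {rs : List (α × List α)} :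
      r ∈ P → ZeroSeqStepWith r x y → DerivList P y rs z → DerivList P x (r :: rs) z

/-- The net effect `df_B(r) = |β|_B − |a|_B` of a production `r = (a, β)`
with respect to the symbol `B`, as an integer. -/
def netEffect {α : Type*} [DecidableEq α] (B : α) (r : α × List α) : ℤ :=
  (r.2.count B : ℤ) - (([r.1] : List α).count B : ℤ)

theorem exists_zeroSeqStepWith_iff {α : Type*} {r : α × List α} {x : List α} :
    (∃ y, ZeroSeqStepWith r x y) ↔ r.1 ∈ x := by
  constructor
  · rintro ⟨_, u, v, rfl, rfl⟩
    simp
  · intro h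
    obtain ⟨u, v, huv⟩ := List.append_of_mem h
    exact ⟨_, u, v, huv, rfl⟩

section ZeroSeq

variable {α : Type*} [DecidableEq α] {P : Finset (α × List α)}

theorem ZeroSeqStepWith.count_eq {r : α × List α} {x y : List α}
    (h : ZeroSeqStepWith r x y) (B : α) :
    (y.count B : ℤ) = x.count B + netEffect B r := by
  obtain ⟨u, v, rfl, rfl⟩ := h
  simp only [netEffect, List.count_append, List.count_cons, List.count_nil]
  push_cast
  ring

theorem DerivList.count_eq {x y : List α} {rs : List (α × List α)}
    (h : DerivList P x rs y) (B : α) :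
    (y.count B : ℤ) = x.count B + (rs.map (netEffect B)).sum := by
  induction h with
  | nil => simp
  | cons _ hs _ ih =>
    rw [ih, hs.count_eq, List.map_cons, List.sum_cons]
    ring

theorem exists_derivList_iff (rs : List (α × List α)) (hrs : ∀ r ∈ rs, r ∈ P) (x : List α) :
    (∃ y, DerivList P x rs y) ↔
      ∀ (i : ℕ) (hi : i < rs.length),
        1 ≤ (x.count (rs.get ⟨i, hi⟩).1 : ℤ) +
          ((rs.take i).map (netEffect (rs.get ⟨i, hi⟩).1)).sum := by
  induction rs generalizing x with
  | nil => exact ⟨fun _ i hi => absurd hi (Nat.not_lt_zero i), fun _ => ⟨x, .nil x⟩⟩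
  | cons r rs ih =>
    have ih := ih fun s hs => hrs s (List.mem_cons_of_mem _ hs)
    constructor
    · rintro ⟨z, h⟩ i hi
      cases h with
      | cons _ hstep htail =>
        cases i with
        | zero =>
          have := List.count_pos_iff.2 (exists_zeroSeqStepWith_iff.1 ⟨_, hstep⟩)
          simpa using this
        | succ i =>
          have := (ih _).1 ⟨z, htail⟩ i (Nat.lt_of_succ_lt_succ hi)
          rw [hstep.count_eq] at this
          simpa [add_assoc] using this
    · intro h
      have hmem : r.1 ∈ x := by simpa using h 0 (Nat.succ_pos _)
      obtain ⟨y, hstep⟩ := exists_zeroSeqStepWith_iff.2 hmem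
      obtain ⟨z, htail⟩ := (ih y).2 fun i hi => by
        rw [hstep.count_eq]
        simpa [add_assoc] using h (i + 1) (Nat.succ_lt_succ hi)
      exact ⟨z, .cons (hrs r List.mem_cons_self) hstep htail⟩

end ZeroSeq

theorem stmt2 {α : Type*} [Fintype α] [DecidableEq α] (P : Finset (α × List α))
    (x : List α) (rs : List (α × List α)) (hrs : ∀ r ∈ rs, r ∈ P) :
    ((∃ y : List α, DerivList P x rs y) ↔
      ∀ (i : ℕ) (hi : i < rs.length),
        1 ≤ (x.count (rs.get ⟨i, hi⟩).1 : ℤ) +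
          ((rs.take i).map (netEffect (rs.get ⟨i, hi⟩).1)).sum) ∧
    (DerivList P x rs [] ↔
      ((∀ (i : ℕ) (hi : i < rs.length),
          1 ≤ (x.count (rs.get ⟨i, hi⟩).1 : ℤ) +
            ((rs.take i).map (netEffect (rs.get ⟨i, hi⟩).1)).sum) ∧
        ∀ B : α, (x.count B : ℤ) + (rs.map (netEffect B)).sum = 0)) := by
  refine ⟨exists_derivList_iff rs hrs x, ?_⟩
  rw [← exists_derivList_iff rs hrs x]
  constructor
  · intro h
    exact ⟨⟨[], h⟩, fun B => by simpa using (h.count_eq B).symm⟩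
  · rintro ⟨⟨y, h⟩, h0⟩
    have hy : y = [] := List.eq_nil_iff_forall_not_mem.2 fun B hB => by
      have := List.count_pos_iff.2 hB
      have := h.count_eq B
      have := h0 B
      omega
    exact hy ▸ h
end

section
/- Over the alphabet Σ = {a, b}, there is no one-state one-counter net whose language equals {aⁿbⁿ : n ≥ 1}. That is, for every choice of effect sets E(x) ⊆ {−1, 0, +1} for the reading moves, effect set Eε ⊆ {−1, 0, +1} for the non-reading moves, ending-letter set F ⊆ Σ, and ε-ending flag, the language of the resulting one-state one-counter net is different from {aⁿbⁿ : n ≥ 1}. -/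
/-- The two-letter alphabet Σ = {a, b}. -/
inductive AB : Type
  | a : AB
  | b : AB
  deriving DecidableEq

/-- `NetAcc E Eε F eps w c` : from the configuration (remaining input `w`, counter `c`)
the one-state one-counter net given by the reading effects `E`, non-reading effects `Eε`,
ending letters `F` and ε-ending flag `eps` has an accepting run.  Every move requires a
counter value ≥ 1:
* reading move: read the next letter `x` and add some `e ∈ E x` to the counter;
* non-reading move: add some `e ∈ Eε` to the counter;
* ending move: if the counter is 1, read the next letter `x ∈ F`, set the counter to 0,
  and accept provided the whole input has now been read;
* ε-ending move (if `eps`): if the counter is 1 and the whole input has been read,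
  set the counter to 0 and accept. -/
inductive NetAcc {α : Type*} (E : α → Set ℤ) (Eε : Set ℤ) (F : Set α) (eps : Prop) :
    List α → ℕ → Prop
  | read {x : α} {w : List α} {c d : ℕ} {e : ℤ} :
      e ∈ E x → (d : ℤ) = (c : ℤ) + 1 + e →
      NetAcc E Eε F eps w d → NetAcc E Eε F eps (x :: w) (c + 1)
  | skip {w : List α} {c d : ℕ} {e : ℤ} :
      e ∈ Eε → (d : ℤ) = (c : ℤ) + 1 + e →
      NetAcc E Eε F eps w d → NetAcc E Eε F eps w (c + 1)
  | endRead {x : α} : x ∈ F → NetAcc E Eε F eps [x] 1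
  | endEps : eps → NetAcc E Eε F eps [] 1

/-- If some word is accepted from some counter value, then the empty word or a one-letter word
is accepted from the counter value `1`. -/
theorem NetAcc.exists_length_le_one {α : Type*} {E : α → Set ℤ} {Eε : Set ℤ} {F : Set α}
    {eps : Prop} {w : List α} {c : ℕ} (h : NetAcc E Eε F eps w c) :
    ∃ v : List α, v.length ≤ 1 ∧ NetAcc E Eε F eps v 1 := by
  induction h with
  | read _ _ _ ih => exact ih
  | skip _ _ _ ih => exact ih
  | endRead hx => exact ⟨_, le_rfl, .endRead hx⟩
  | endEps h => exact ⟨[], Nat.zero_le _, .endEps h⟩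

/-- No one-state one-counter net over {a, b} has language {aⁿbⁿ : n ≥ 1}. -/
theorem stmt11 (E : AB → Set ℤ) (Eε : Set ℤ) (F : Set AB) (eps : Prop)
    (hE : ∀ x, E x ⊆ {-1, 0, 1}) (hEε : Eε ⊆ {-1, 0, 1}) :
    {w : List AB | NetAcc E Eε F eps w 1} ≠
      {w : List AB | ∃ n : ℕ, 1 ≤ n ∧
        w = List.replicate n AB.a ++ List.replicate n AB.b} := by
  intro h
  have hab : NetAcc E Eε F eps [AB.a, AB.b] 1 := (Set.ext_iff.mp h _).mpr ⟨1, le_rfl, rfl⟩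
  obtain ⟨v, hv, hacc⟩ := hab.exists_length_le_one
  obtain ⟨n, hn, rfl⟩ := (Set.ext_iff.mp h v).mp hacc
  simp only [List.length_append, List.length_replicate] at hv
  omega
end

section
/- Over the alphabet Σ = {a, b}, there is no one-state counter system with zero-tests whose language equals {aⁿbⁿ : n ≥ 0}. That is, for every choice of a set of available rules among the types ψ₁(x), ψ₂(x), ψ₃(x), ψ₄(x), ψ₅(x), ψ₆(x) (for letters x ∈ Σ) and ψ₇, ψ₈, ψ₉, ψ₁₀, the language of the resulting one-state counter system is different from {aⁿbⁿ : n ≥ 0}. -/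
/-- The available rule types of a one-state counter system (an (RL₁; RB_c)-system):
for each reading rule type ψ₁(x), …, ψ₆(x) the predicate tells for which letters `x`
the rule is available, and the propositions tell whether ψ₇, ψ₈, ψ₉, ψ₁₀ are available. -/
structure OCRules (α : Type*) where
  psi1 : α → Prop
  psi2 : α → Prop
  psi3 : α → Prop
  psi4 : α → Prop
  psi5 : α → Prop
  psi6 : α → Prop
  psi7 : Prop
  psi8 : Prop
  psi9 : Prop
  psi10 : Prop

/-- `OCAccepts R w c` : from the configuration (remaining input `w`, counter `c`)
there is a run of the one-state counter system with rules `R` ending in acceptance.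
  ψ₁(x): if c = 0, read x, keep c = 0;   ψ₂(x): if c = 0, read x, set c := 1;
  ψ₃(x): if c ≥ 1, read x, c := c + 1;   ψ₄(x): if c ≥ 1, read x, keep c;
  ψ₅(x): if c ≥ 1, read x, c := c − 1;   ψ₆(x): if c = 0, read x and accept if input done;
  ψ₇: if c = 0, c := 1 (no read);        ψ₈: if c ≥ 1, c := c + 1 (no read);
  ψ₉: if c ≥ 1, c := c − 1 (no read);    ψ₁₀: if c = 0 and input done, accept. -/
inductive OCAccepts {α : Type*} (R : OCRules α) : List α → ℕ → Prop
  | psi1 {x : α} {w : List α} : R.psi1 x → OCAccepts R w 0 → OCAccepts R (x :: w) 0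
  | psi2 {x : α} {w : List α} : R.psi2 x → OCAccepts R w 1 → OCAccepts R (x :: w) 0
  | psi3 {x : α} {w : List α} {c : ℕ} :
      R.psi3 x → OCAccepts R w (c + 2) → OCAccepts R (x :: w) (c + 1)
  | psi4 {x : α} {w : List α} {c : ℕ} :
      R.psi4 x → OCAccepts R w (c + 1) → OCAccepts R (x :: w) (c + 1)
  | psi5 {x : α} {w : List α} {c : ℕ} :
      R.psi5 x → OCAccepts R w c → OCAccepts R (x :: w) (c + 1)
  | psi6 {x : α} : R.psi6 x → OCAccepts R [x] 0
  | psi7 {w : List α} : R.psi7 → OCAccepts R w 1 → OCAccepts R w 0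
  | psi8 {w : List α} {c : ℕ} : R.psi8 → OCAccepts R w (c + 2) → OCAccepts R w (c + 1)
  | psi9 {w : List α} {c : ℕ} : R.psi9 → OCAccepts R w c → OCAccepts R w (c + 1)
  | psi10 : R.psi10 → OCAccepts R [] 0

/-- A run from counter `0` can be started after any accepting run that does not end with `ψ₆`,
since the latter also ends at counter `0`. -/
theorem OCAccepts.append {α : Type*} {R : OCRules α} (h6 : ∀ x, ¬ R.psi6 x) {v w : List α} {c : ℕ}
    (hw : OCAccepts R w c) (hv : OCAccepts R v 0) : OCAccepts R (w ++ v) c := by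
  induction hw with
  | psi1 h _ ih => exact .psi1 h ih
  | psi2 h _ ih => exact .psi2 h ih
  | psi3 h _ ih => exact .psi3 h ih
  | psi4 h _ ih => exact .psi4 h ih
  | psi5 h _ ih => exact .psi5 h ih
  | psi6 h => exact absurd h (h6 _)
  | psi7 h _ ih => exact .psi7 h ih
  | psi8 h _ ih => exact .psi8 h ih
  | psi9 h _ ih => exact .psi9 h ih
  | psi10 _ => exact hv

/-- No one-state counter system (with zero-tests) over {a, b}, whatever its set of
available rules among the types ψ₁(x), …, ψ₆(x), ψ₇, ψ₈, ψ₉, ψ₁₀, has language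
{aⁿbⁿ : n ≥ 0}. -/
theorem stmt13 (R : OCRules AB) :
    {w : List AB | OCAccepts R w 0} ≠
      {w : List AB | ∃ n : ℕ, w = List.replicate n AB.a ++ List.replicate n AB.b} := by
  intro h
  have mem_iff (w : List AB) : OCAccepts R w 0 ↔
      ∃ n : ℕ, w = List.replicate n AB.a ++ List.replicate n AB.b := Set.ext_iff.mp h w
  have h6 (x : AB) : ¬ R.psi6 x := by
    intro hx
    obtain ⟨n, hn⟩ := (mem_iff [x]).mp (.psi6 hx)
    have hlen := congrArg List.length hn
    simp only [List.length_singleton, List.length_append, List.length_replicate] at hlen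
    omega
  have hab : OCAccepts R [AB.a, AB.b] 0 := (mem_iff _).mpr ⟨1, rfl⟩
  obtain ⟨n, hn⟩ := (mem_iff _).mp (hab.append h6 hab)
  have hlen := congrArg List.length hn
  simp only [List.length_append, List.length_cons, List.length_nil,
    List.length_replicate] at hlen
  obtain rfl : n = 2 := by omega
  simp [List.replicate] at hn
end
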